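/- arXiv:1203.0498 — 3 statements merged into one kernel-verified Lean document; each statement's English description precedes it below -/
import Mathlib

section
/- Let a > 1 and b > 0. Then the characteristic polynomial of A = [[0,1,0,0],[−a,0,1,0],[0,0,0,1],[b,0,−b,0]] factors over ℝ as (X² + ω₁²)(X² + ω₂²), and the eigenvalues of A, regarded as a complex matrix, are exactly the four purely imaginary numbers iω₁, −iω₁, iω₂, −iω₂. -/
open Polynomial

theorem charpoly_doublePendulum {R : Type*} [CommRing R] (a b : R) :
    (!![0, 1, 0, 0; -a, 0, 1, 0; 0, 0, 0, 1; b, 0, -b, 0] : Matrix (Fin 4) (Fin 4) R).charpoly =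
      X ^ 4 + C (a + b) * X ^ 2 + C (a * b - b) := by
  simp [Matrix.charpoly, Matrix.charmatrix, Matrix.det_succ_row_zero, Fin.sum_univ_succ,
    Fin.succAbove]
  ring

theorem Complex.sq_add_ofReal_sq_eq_zero_iff (z : ℂ) (w : ℝ) :
    z ^ 2 + (w : ℂ) ^ 2 = 0 ↔ z = Complex.I * w ∨ z = -(Complex.I * w) := by
  rw [← sq_eq_sq_iff_eq_or_eq_neg, mul_pow, Complex.I_sq, neg_one_mul, eq_neg_iff_add_eq_zero]

/-- For `a > 1`, `b > 0`, `Δ = (a−b)² + 4b`, `ω₁ = √((a+b−√Δ)/2)`,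
`ω₂ = √((a+b+√Δ)/2)`, the characteristic polynomial of the linearization matrix
`A = [[0,1,0,0],[−a,0,1,0],[0,0,0,1],[b,0,−b,0]]` of the unperturbed double pendulum factors
over `ℝ` as `(X² + ω₁²)(X² + ω₂²)`, and the eigenvalues of `A` as a complex matrix are exactly
`iω₁, −iω₁, iω₂, −iω₂`. -/
theorem stmt6 (a b : ℝ) (ha : 1 < a) (hb : 0 < b)
    (Δ ω₁ ω₂ : ℝ)
    (hΔ : Δ = (a - b) ^ 2 + 4 * b)
    (hω₁ : ω₁ = Real.sqrt ((a + b - Real.sqrt Δ) / 2))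
    (hω₂ : ω₂ = Real.sqrt ((a + b + Real.sqrt Δ) / 2))
    (A : Matrix (Fin 4) (Fin 4) ℝ)
    (hA : A = !![0, 1, 0, 0; -a, 0, 1, 0; 0, 0, 0, 1; b, 0, -b, 0]) :
    A.charpoly = (X ^ 2 + C (ω₁ ^ 2)) * (X ^ 2 + C (ω₂ ^ 2)) ∧
      spectrum ℂ (A.map (Complex.ofReal : ℝ → ℂ)) =
        {Complex.I * (ω₁ : ℂ), -(Complex.I * (ω₁ : ℂ)),
         Complex.I * (ω₂ : ℂ), -(Complex.I * (ω₂ : ℂ))} := by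
  have hΔ_sq : Real.sqrt Δ ^ 2 = (a - b) ^ 2 + 4 * b := by
    rw [Real.sq_sqrt (hΔ ▸ by positivity), hΔ]
  have hΔ_le : Real.sqrt Δ ≤ a + b :=
    abs_le_of_sq_le_sq' (by nlinarith [mul_pos hb (sub_pos.2 ha)]) (by positivity) |>.2
  have h₁ : ω₁ ^ 2 = (a + b - Real.sqrt Δ) / 2 := by
    rw [hω₁, Real.sq_sqrt (by linarith)]
  have h₂ : ω₂ ^ 2 = (a + b + Real.sqrt Δ) / 2 := by
    rw [hω₂, Real.sq_sqrt (by positivity)]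
  have h_sum : a + b = ω₁ ^ 2 + ω₂ ^ 2 := by rw [h₁, h₂]; ring
  have h_prod : a * b - b = ω₁ ^ 2 * ω₂ ^ 2 := by rw [h₁, h₂]; linarith
  have h_char : A.charpoly = (X ^ 2 + C (ω₁ ^ 2)) * (X ^ 2 + C (ω₂ ^ 2)) := by
    rw [hA, charpoly_doublePendulum, h_sum, h_prod, C_add, C_mul]
    ring
  refine ⟨h_char, ?_⟩
  ext z
  have h_map : (A.map (Complex.ofReal : ℝ → ℂ)).charpoly = A.charpoly.map Complex.ofRealHom :=
    A.charpoly_map Complex.ofRealHom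
  rw [Matrix.mem_spectrum_iff_isRoot_charpoly, h_map, h_char]
  simp [Complex.sq_add_ofReal_sq_eq_zero_iff, or_assoc]
end

section
/- Let a > 1 and b > 0, Δ = (a−b)² + 4b, ω₁ = √((a+b−√Δ)/2), ω₂ = √((a+b+√Δ)/2). Let P be the 4×4 real matrix with rows (bω₁/√Δ, 0, ω₁(a−b+√Δ)/(2√Δ), 0), (0, b/√Δ, 0, (a−b+√Δ)/(2√Δ)), (−bω₂/√Δ, 0, ω₂(−a+b+√Δ)/(2√Δ), 0), (0, −b/√Δ, 0, (−a+b+√Δ)/(2√Δ)), let A = [[0,1,0,0],[−a,0,1,0],[0,0,0,1],[b,0,−b,0]], and let J be the block-diagonal matrix [[0,ω₁,0,0],[−ω₁,0,0,0],[0,0,0,ω₂],[0,0,−ω₂,0]]. Then P·A = J·P and det P = b²ω₁ω₂/Δ ≠ 0; in particular the linear change of variables (X,Y,Z,W)ᵀ = P·(x,y,z,w)ᵀ brings the linear part of the unperturbed double pendulum system into its real normal Jordan form J. -/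
/-- With `a > 1`, `b > 0`, `Δ = (a−b)² + 4b`, `ω₁ = √((a+b−√Δ)/2)`,
`ω₂ = √((a+b+√Δ)/2)`, the matrix `P` of the change of variables `(X,Y,Z,W)ᵀ = P(x,y,z,w)ᵀ`
satisfies `P·A = J·P` and `det P = b²ω₁ω₂/Δ ≠ 0`, where `A` is the matrix of the linearization
at the origin of the unperturbed double pendulum `x' = y, y' = −ax + z, z' = w, w' = bx − bz`
and `J` is its real normal Jordan form; i.e. this linear change of variables brings the linear
part of the unperturbed system into its real normal Jordan form `J`. -/
theorem stmt9 (a b : ℝ) (ha : 1 < a) (hb : 0 < b)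
    (Δ ω₁ ω₂ : ℝ)
    (hΔ : Δ = (a - b) ^ 2 + 4 * b)
    (hω₁ : ω₁ = Real.sqrt ((a + b - Real.sqrt Δ) / 2))
    (hω₂ : ω₂ = Real.sqrt ((a + b + Real.sqrt Δ) / 2))
    (P A J : Matrix (Fin 4) (Fin 4) ℝ)
    (hP : P = !![b * ω₁ / Real.sqrt Δ, 0, ω₁ * (a - b + Real.sqrt Δ) / (2 * Real.sqrt Δ), 0;
                 0, b / Real.sqrt Δ, 0, (a - b + Real.sqrt Δ) / (2 * Real.sqrt Δ);
                 -(b * ω₂ / Real.sqrt Δ), 0, ω₂ * (-a + b + Real.sqrt Δ) / (2 * Real.sqrt Δ), 0;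
                 0, -(b / Real.sqrt Δ), 0, (-a + b + Real.sqrt Δ) / (2 * Real.sqrt Δ)])
    (hA : A = !![0, 1, 0, 0; -a, 0, 1, 0; 0, 0, 0, 1; b, 0, -b, 0])
    (hJ : J = !![0, ω₁, 0, 0; -ω₁, 0, 0, 0; 0, 0, 0, ω₂; 0, 0, -ω₂, 0]) :
    P * A = J * P ∧ P.det = b ^ 2 * ω₁ * ω₂ / Δ ∧ P.det ≠ 0 := by
  have hΔpos : 0 < Δ := by rw [hΔ]; positivity
  have hs_pos : 0 < Real.sqrt Δ := Real.sqrt_pos.2 hΔpos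
  have hs_sq : Real.sqrt Δ ^ 2 = Δ := Real.sq_sqrt hΔpos.le
  have hs_lt : Real.sqrt Δ < a + b := by
    rw [Real.sqrt_lt' (by linarith), hΔ]
    nlinarith [mul_pos hb (sub_pos.2 ha)]
  have hω₁_pos : 0 < ω₁ := by rw [hω₁]; exact Real.sqrt_pos.2 (by linarith)
  have hω₂_pos : 0 < ω₂ := by rw [hω₂]; exact Real.sqrt_pos.2 (by linarith)
  have hω₁_sq : ω₁ ^ 2 = (a + b - Real.sqrt Δ) / 2 := by
    rw [hω₁]; exact Real.sq_sqrt (by linarith)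
  have hω₂_sq : ω₂ ^ 2 = (a + b + Real.sqrt Δ) / 2 := by
    rw [hω₂]; exact Real.sq_sqrt (by linarith)
  clear hω₁ hω₂
  generalize Real.sqrt Δ = s at *
  have hs : s ≠ 0 := hs_pos.ne'
  have hdet : P.det = b ^ 2 * ω₁ * ω₂ / Δ := by
    rw [hP, ← hs_sq]
    simp [Matrix.det_succ_row_zero, Fin.sum_univ_succ, Fin.succAbove]
    field_simp
    ring
  refine ⟨?_, hdet, ?_⟩
  · rw [hP, hA, hJ]
    ext i j
    fin_cases i <;> fin_cases j <;>
      simp [Matrix.mul_apply, Fin.sum_univ_succ] <;> field_simp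
    · linear_combination 2 * hω₁_sq
    · linear_combination (a - b + s) * hω₁_sq - (hΔ + hs_sq) / 2
    · linear_combination -2 * hω₂_sq
    · linear_combination (-a + b + s) * hω₂_sq + (hΔ + hs_sq) / 2
  · rw [hdet]
    positivity
end

section
/- Let ω > 0, p a positive integer, and (X₀,Y₀) ∈ ℝ² with (X₀,Y₀) ≠ (0,0). Then ∫₀^{2pπ/ω} sin(ωτ)·sgn(Y₀ cos(ωτ) + X₀ sin(ωτ)) dτ = 4pX₀/(ω√(X₀² + Y₀²)). -/
open MeasureTheory in
/-- The integral of `sin x` against the sign of a phase-shifted sine over one period. -/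
theorem integral_sin_mul_sign_sin_add (a : ℝ) :
    IntervalIntegrable (fun x => Real.sin x * Real.sign (Real.sin (x + a))) volume
        (-a) (-a + 2 * Real.pi) ∧
      ∫ x in (-a)..(-a + 2 * Real.pi), Real.sin x * Real.sign (Real.sin (x + a))
        = 4 * Real.cos a := by
  have hpi := Real.pi_pos
  have pos : Set.EqOn Real.sin (fun x => Real.sin x * Real.sign (Real.sin (x + a)))
      (Set.uIoo (-a) (-a + Real.pi)) := by
    intro x hx
    rw [Set.uIoo_of_le (by linarith)] at hx
    have hs : 0 < Real.sin (x + a) :=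
      Real.sin_pos_of_pos_of_lt_pi (by linarith [hx.1]) (by linarith [hx.2])
    simp [Real.sign_of_pos hs]
  have neg : Set.EqOn (fun x => -Real.sin x)
      (fun x => Real.sin x * Real.sign (Real.sin (x + a)))
      (Set.uIoo (-a + Real.pi) (-a + 2 * Real.pi)) := by
    intro x hx
    rw [Set.uIoo_of_le (by linarith)] at hx
    have hs : Real.sin (x + a) < 0 := by
      rw [← Real.sin_sub_two_pi]
      exact Real.sin_neg_of_neg_of_neg_pi_lt (by linarith [hx.2]) (by linarith [hx.1])
    simp [Real.sign_of_neg hs]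
  have int_pos := (Real.continuous_sin.intervalIntegrable (μ := volume)
    (-a) (-a + Real.pi)).congr_uIoo pos
  have int_neg := (Real.continuous_sin.neg.intervalIntegrable (μ := volume)
    (-a + Real.pi) (-a + 2 * Real.pi)).congr_uIoo neg
  refine ⟨int_pos.trans int_neg, ?_⟩
  rw [← intervalIntegral.integral_add_adjacent_intervals int_pos int_neg,
    ← intervalIntegral.integral_congr_uIoo pos, ← intervalIntegral.integral_congr_uIoo neg,
    intervalIntegral.integral_neg, integral_sin, integral_sin, Real.cos_add_two_pi,
    Real.cos_add_pi, Real.cos_neg]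
  ring

/-- A nonzero vector of the plane in polar coordinates. -/
theorem exists_polar_of_ne_zero (X Y : ℝ) (h : (X, Y) ≠ (0, 0)) :
    0 < √(X ^ 2 + Y ^ 2) ∧
      ∃ a, X = √(X ^ 2 + Y ^ 2) * Real.cos a ∧ Y = √(X ^ 2 + Y ^ 2) * Real.sin a := by
  have hz : (⟨X, Y⟩ : ℂ) ≠ 0 := fun hz => h (by
    rw [Complex.ext_iff] at hz
    exact Prod.ext hz.1 hz.2)
  have hn : ‖(⟨X, Y⟩ : ℂ)‖ = √(X ^ 2 + Y ^ 2) := Complex.norm_eq_sqrt_sq_add_sq _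
  rw [← hn]
  exact ⟨norm_pos_iff.2 hz, Complex.arg ⟨X, Y⟩, (Complex.norm_mul_cos_arg ⟨X, Y⟩).symm,
    (Complex.norm_mul_sin_arg ⟨X, Y⟩).symm⟩

theorem Real.sign_mul_of_pos {r : ℝ} (hr : 0 < r) (x : ℝ) : Real.sign (r * x) = Real.sign x := by
  rcases lt_trichotomy x 0 with hx | rfl | hx
  · rw [Real.sign_of_neg hx, Real.sign_of_neg (mul_neg_of_pos_of_neg hr hx)]
  · rw [mul_zero]
  · rw [Real.sign_of_pos hx, Real.sign_of_pos (mul_pos hr hx)]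

/-- For `ω > 0`, `p` a positive integer and `(X₀,Y₀) ≠ (0,0)`,
`∫₀^{2pπ/ω} sin(ωτ)·sgn(Y₀cos(ωτ) + X₀sin(ωτ)) dτ = 4pX₀/(ω√(X₀²+Y₀²))`,
where `sgn u = 1` for `u > 0`, `−1` for `u < 0` and `0` at `0`.  This integral arises in the
averaged function `ℱ₁` of the non-smooth perturbed double pendulum. -/
theorem stmt14 (ω : ℝ) (hω : 0 < ω) (p : ℕ) (hp : 0 < p)
    (X₀ Y₀ : ℝ) (h : (X₀, Y₀) ≠ (0, 0)) :
    ∫ τ in (0 : ℝ)..(2 * (p : ℝ) * Real.pi / ω),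
        Real.sin (ω * τ) * Real.sign (Y₀ * Real.cos (ω * τ) + X₀ * Real.sin (ω * τ))
      = 4 * (p : ℝ) * X₀ / (ω * Real.sqrt (X₀ ^ 2 + Y₀ ^ 2)) := by
  obtain ⟨hr, a, hX, hY⟩ := exists_polar_of_ne_zero X₀ Y₀ h
  set r := √(X₀ ^ 2 + Y₀ ^ 2)
  let f : ℝ → ℝ := fun x => Real.sin x * Real.sign (Real.sin (x + a))
  have hf (τ : ℝ) : Real.sin (ω * τ) *
      Real.sign (Y₀ * Real.cos (ω * τ) + X₀ * Real.sin (ω * τ)) = f (ω * τ) := by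
    have hphase : Y₀ * Real.cos (ω * τ) + X₀ * Real.sin (ω * τ)
        = r * Real.sin (ω * τ + a) := by
      rw [Real.sin_add, hX, hY]
      ring
    rw [hphase, Real.sign_mul_of_pos hr]
  have hper : Function.Periodic f (2 * Real.pi) := fun x => by
    simp only [f, add_right_comm x, Real.sin_add_two_pi]
  obtain ⟨hperiod, hval⟩ := integral_sin_mul_sign_sin_add a
  have integrable (s t : ℝ) : IntervalIntegrable f MeasureTheory.volume s t :=
    hper.intervalIntegrable Real.two_pi_pos.ne' hperiod s t
  have hperiods : ∫ x in (0 : ℝ)..(2 * (p : ℝ) * Real.pi), f x = p * (4 * Real.cos a) := by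
    have := hper.intervalIntegral_add_zsmul_eq p 0 integrable
    rw [hper.intervalIntegral_add_eq 0 (-a), hval] at this
    simp only [zero_add, zsmul_eq_mul, Int.cast_natCast] at this
    rw [← this]
    congr 1
    ring
  have hupper : ω * (2 * (p : ℝ) * Real.pi / ω) = 2 * p * Real.pi := by field_simp
  simp_rw [hf]
  rw [intervalIntegral.integral_comp_mul_left _ hω.ne', mul_zero, hupper, hperiods, smul_eq_mul]
  have hcos : Real.cos a = X₀ / r := by rw [eq_div_iff hr.ne', mul_comm, ← hX]
  rw [hcos]
  field_simp
end
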